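/- arXiv:2106.13721 — 2 statements merged into one kernel-verified Lean document; each statement's English description precedes it below -/
import Mathlib

section
/- Let A be a real m×n matrix and b ∈ ℝᵐ. Let J be a finite index set and for each j ∈ J let W_j ∈ ℝ^{n×m}, β_j ∈ ℝᵐ, and set C_j := Aᵀ W_jᵀ + W_j A, c_j := Aᵀ β_j − 2 W_j b, γ_j := −bᵀ β_j. Suppose there exist real scalars ω_j, j ∈ J, such that Σ_{j∈J} ω_j W_j = Aᵀ. Let x̄ ∈ ℝⁿ and let X̄ be a real symmetric n×n matrix such that A x̄ = b and ⟨C_j, X̄⟩ + c_jᵀ x̄ + γ_j = 0 for all j ∈ J. Then ⟨AᵀA, X̄ − x̄ x̄ᵀ⟩ = 0, i.e., ⟨AᵀA, X̄⟩ − 2(Aᵀ b)ᵀ x̄ + bᵀ b = 0. (Hence under this condition the feasible regions of SDPdaJ and SDPda coincide.) -/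
open Matrix

/-- The entrywise inner product against a symmetric matrix is invariant under transposition. -/
lemma sum_transpose_mul_of_isSymm {ι R : Type*} [Fintype ι] [NonUnitalNonAssocSemiring R]
    (M : Matrix ι ι R) {P : Matrix ι ι R} (hP : P.IsSymm) :
    ∑ i, ∑ k, Mᵀ i k * P i k = ∑ i, ∑ k, M i k * P i k := by
  rw [Finset.sum_comm]
  simp only [transpose_apply, hP.apply]

/-- The entrywise inner product with the rank-one matrix `x yᵀ` is the bilinear form `xᵀ M y`. -/
lemma sum_mul_vecMulVec {ι κ R : Type*} [Fintype ι] [Fintype κ] [CommSemiring R]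
    (M : Matrix ι κ R) (x : ι → R) (y : κ → R) :
    ∑ i, ∑ k, M i k * vecMulVec x y i k = x ⬝ᵥ M *ᵥ y := by
  simp only [dotProduct, mulVec, vecMulVec_apply, Finset.mul_sum]
  exact Finset.sum_congr rfl fun i _ => Finset.sum_congr rfl fun k _ => by ring

/-- If the lifted quadratics `(C_j, c_j, γ_j)` built from `W_j`, `β_j` admit a
linear combination with `Σ ω_j W_j = Aᵀ`, then any `(xb, Xb)` satisfying
`A xb = b` and all lifted constraints also satisfies
`⟨AᵀA, Xb⟩ − 2(Aᵀb)ᵀxb + bᵀb = 0`;  hence the feasible regions of (SDPdaJ)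
and (SDPda) coincide. -/
theorem stmt_11 {m n : ℕ} {ι : Type*} [Fintype ι]
    (A : Matrix (Fin m) (Fin n) ℝ) (b : Fin m → ℝ)
    (W : ι → Matrix (Fin n) (Fin m) ℝ) (β : ι → (Fin m → ℝ))
    (ω : ι → ℝ) (hω : ∑ j, ω j • W j = Aᵀ)
    (xb : Fin n → ℝ) (Xb : Matrix (Fin n) (Fin n) ℝ) (hXb : Xb.IsSymm)
    (hAx : A.mulVec xb = b)
    (hJ : ∀ j : ι,
      (∑ i, ∑ k, (Aᵀ * (W j)ᵀ + W j * A) i k * Xb i k)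
        + (Aᵀ.mulVec (β j) - (2 : ℝ) • (W j).mulVec b) ⬝ᵥ xb
        + (-(b ⬝ᵥ β j)) = 0) :
    (∑ i, ∑ k, (Aᵀ * A) i k * (Xb - Matrix.vecMulVec xb xb) i k = 0) ∧
    (∑ i, ∑ k, (Aᵀ * A) i k * Xb i k)
      - 2 * ((Aᵀ.mulVec b) ⬝ᵥ xb) + b ⬝ᵥ b = 0 := by
  have hW (j : ι) : ∑ i, ∑ k, (W j * A) i k * Xb i k = xb ⬝ᵥ W j *ᵥ b := by
    have hC : ∑ i, ∑ k, (Aᵀ * (W j)ᵀ + W j * A) i k * Xb i k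
        = 2 * ∑ i, ∑ k, (W j * A) i k * Xb i k := by
      simp only [← transpose_mul, Matrix.add_apply, add_mul, Finset.sum_add_distrib,
        sum_transpose_mul_of_isSymm _ hXb, two_mul]
    have hc : (Aᵀ *ᵥ β j - (2 : ℝ) • W j *ᵥ b) ⬝ᵥ xb
        = b ⬝ᵥ β j - 2 * (xb ⬝ᵥ W j *ᵥ b) := by
      rw [sub_dotProduct, smul_dotProduct, mulVec_transpose, ← dotProduct_mulVec, hAx,
        dotProduct_comm (β j), dotProduct_comm (W j *ᵥ b), smul_eq_mul]
    have h := hJ j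
    rw [hC, hc] at h
    linarith
  have hX : ∑ i, ∑ k, (Aᵀ * A) i k * Xb i k = xb ⬝ᵥ Aᵀ *ᵥ b := by
    calc ∑ i, ∑ k, (Aᵀ * A) i k * Xb i k
        = ∑ j, ω j * ∑ i, ∑ k, (W j * A) i k * Xb i k := by
          simp only [← hω, Matrix.sum_mul, Finset.sum_mul, Matrix.sum_apply, Matrix.smul_mul,
            Matrix.smul_apply, smul_eq_mul, Finset.mul_sum, mul_assoc]
          rw [Finset.sum_comm (s := (Finset.univ : Finset ι))]
          exact Finset.sum_congr rfl fun i _ => Finset.sum_comm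
      _ = xb ⬝ᵥ Aᵀ *ᵥ b := by
          simp only [hW, ← hω, sum_mulVec, dotProduct_sum, smul_mulVec, dotProduct_smul,
            smul_eq_mul]
  have hxb : xb ⬝ᵥ Aᵀ *ᵥ b = b ⬝ᵥ b := by
    rw [dotProduct_mulVec, vecMul_transpose, hAx]
  constructor
  · simp only [Matrix.sub_apply, mul_sub, Finset.sum_sub_distrib]
    rw [sum_mul_vecMulVec, hX, ← mulVec_mulVec, hAx, sub_self]
  · rw [hX, dotProduct_comm _ xb, hxb]
    ring
end

section
/- Let Q be a real symmetric n×n matrix, q ∈ ℝⁿ, A ∈ ℝ^{m×n}, b ∈ ℝᵐ, and for each i ∈ {1,…,n} let S_i ⊆ ℝ and C_i := {(s, s²) : s ∈ S_i} ⊆ ℝ². Let J be a finite index set and for each j ∈ J let W_j ∈ ℝ^{n×m}, β_j ∈ ℝᵐ, and set C_j := Aᵀ W_jᵀ + W_j A, c_j := Aᵀ β_j − 2 W_j b, γ_j := −bᵀ β_j. Define the common base set G of triples (x, y, X) with x, y ∈ ℝⁿ and X a symmetric n×n matrix satisfying: A x = b, X − x xᵀ positive semidefinite, Xᵢᵢ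 = yᵢ for all i, and (xᵢ, yᵢ) ∈ conv(C_i) for all i. Let F_da := {(x,y,X) ∈ G : ⟨AᵀA, X⟩ − 2(Aᵀ b)ᵀ x + bᵀ b = 0} and F_daJ := {(x,y,X) ∈ G : ⟨C_j, X⟩ + c_jᵀ x + γ_j = 0 for all j ∈ J}. If F_da is nonempty and the set {⟨Q, X⟩ + qᵀ x : (x,y,X) ∈ F_daJ} is bounded below, then inf{⟨Q, X⟩ + qᵀ x : (x,y,X) ∈ F_daJ} ≤ inf{⟨Q, X⟩ + qᵀ x : (x,y,X) ∈ F_da}, i.e., μ_SDPdaJ ≤ μ_SDPda. -/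
open Matrix

/-- If `Y` is positive semidefinite and `A Y Aᵀ` has trace zero, then `A Y = 0`. -/
lemma Matrix.PosSemidef.mul_eq_zero_of_trace_conj_eq_zero {m n : Type*} [Fintype m] [Fintype n]
    {Y : Matrix n n ℝ} (hY : Y.PosSemidef) (A : Matrix m n ℝ)
    (h : (A * Y * Aᵀ).trace = 0) : A * Y = 0 := by
  have hpsd : (A * Y * Aᵀ).PosSemidef := by
    simpa using hY.mul_mul_conjTranspose_same A
  have hzero : A * Y * Aᵀ = 0 := hpsd.trace_eq_zero_iff.mp h
  have hsymm : Yᵀ = Y := by simpa using hY.isHermitian.eq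
  ext i k
  have hrow : star (A i) ⬝ᵥ Y.mulVec (A i) = 0 := by
    have hi := congrFun (congrFun hzero i) i
    rw [Matrix.mul_assoc] at hi
    exact hi
  have hk := congrFun ((hY.dotProduct_mulVec_zero_iff (A i)).mp hrow) k
  rw [← hsymm, Matrix.mulVec_transpose] at hk
  exact hk

lemma Matrix.sum_sum_mul_eq_trace {m n : Type*} [Fintype m] [Fintype n]
    (M X : Matrix m n ℝ) : (∑ i, ∑ j, M i j * X i j) = (M * Xᵀ).trace := by
  simp [Matrix.trace, Matrix.mul_apply]

/-- The aggregated constraint forces `A X = b xᵀ`. -/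
lemma Matrix.mul_eq_vecMulVec_of_aggregated {m n : Type*} [Fintype m] [Fintype n]
    {A : Matrix m n ℝ} {b : m → ℝ} {x : n → ℝ} {X : Matrix n n ℝ}
    (hX : X.IsSymm) (hAx : A.mulVec x = b) (hpsd : (X - vecMulVec x x).PosSemidef)
    (h : (∑ i, ∑ j, (Aᵀ * A) i j * X i j) - 2 * ((Aᵀ.mulVec b) ⬝ᵥ x) + b ⬝ᵥ b = 0) :
    A * X = vecMulVec b x := by
  have hb : (Aᵀ.mulVec b) ⬝ᵥ x = b ⬝ᵥ b := by
    rw [mulVec_transpose, ← dotProduct_mulVec, hAx]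
  rw [sum_sum_mul_eq_trace, hX.eq, hb, Matrix.mul_assoc, trace_mul_comm] at h
  have htr : (A * (X - vecMulVec x x) * Aᵀ).trace = 0 := by
    rw [Matrix.mul_sub, Matrix.sub_mul, trace_sub, mul_vecMulVec, hAx, vecMulVec_mul,
      vecMul_transpose, hAx, trace_vecMulVec]
    linarith
  have hz := hpsd.mul_eq_zero_of_trace_conj_eq_zero A htr
  rw [Matrix.mul_sub, mul_vecMulVec, hAx, sub_eq_zero] at hz
  exact hz

/-- If `A x = b` and `A X = b xᵀ`, then the lift of any quadratic vanishing on
`{x : A x = b}` vanishes at `(x, X)`. -/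
lemma Matrix.lifted_vanishing_quadratic_eq_zero {m n : Type*} [Fintype m] [Fintype n]
    {A : Matrix m n ℝ} {b : m → ℝ} {x : n → ℝ} {X : Matrix n n ℝ}
    (hX : X.IsSymm) (hAx : A.mulVec x = b) (hAX : A * X = vecMulVec b x)
    (W : Matrix n m ℝ) (β : m → ℝ) :
    (∑ i, ∑ k, (Aᵀ * Wᵀ + W * A) i k * X i k)
      + (Aᵀ.mulVec β - (2 : ℝ) • W.mulVec b) ⬝ᵥ x + -(b ⬝ᵥ β) = 0 := by
  have hright : (W * A * X).trace = W.mulVec b ⬝ᵥ x := by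
    rw [Matrix.mul_assoc, hAX, mul_vecMulVec, trace_vecMulVec]
  have hleft : (Aᵀ * Wᵀ * X).trace = W.mulVec b ⬝ᵥ x := by
    rw [← hright, ← trace_transpose (W * A * X), transpose_mul, transpose_mul, hX.eq,
      trace_mul_comm]
  have hβ : (Aᵀ.mulVec β) ⬝ᵥ x = b ⬝ᵥ β := by
    rw [mulVec_transpose, ← dotProduct_mulVec, hAx, dotProduct_comm]
  rw [sum_sum_mul_eq_trace, hX.eq, Matrix.add_mul, trace_add, hleft, hright, sub_dotProduct,
    smul_dotProduct, hβ, smul_eq_mul]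
  ring

/-- `μ_SDPdaJ ≤ μ_SDPda`: the SDP relaxation with the single aggregated
constraint `⟨AᵀA, X⟩ − 2(Aᵀb)ᵀx + bᵀb = 0` is the tightest among the class of
relaxations built from lifted quadratics vanishing on `{x : A x = b}`. -/
theorem stmt_12 {m n : ℕ} {ι : Type*} [Fintype ι]
    (Q : Matrix (Fin n) (Fin n) ℝ) (hQ : Q.IsSymm) (q : Fin n → ℝ)
    (A : Matrix (Fin m) (Fin n) ℝ) (b : Fin m → ℝ)
    (S : Fin n → Set ℝ)
    (W : ι → Matrix (Fin n) (Fin m) ℝ) (β : ι → (Fin m → ℝ))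
    (Cq : ι → Matrix (Fin n) (Fin n) ℝ) (cq : ι → (Fin n → ℝ)) (γq : ι → ℝ)
    (hCdef : ∀ j, Cq j = Aᵀ * (W j)ᵀ + W j * A)
    (hcdef : ∀ j, cq j = Aᵀ.mulVec (β j) - (2 : ℝ) • (W j).mulVec b)
    (hγdef : ∀ j, γq j = -(b ⬝ᵥ β j))
    (Cset : Fin n → Set (ℝ × ℝ))
    (hCset : ∀ i, Cset i = {p : ℝ × ℝ | ∃ s ∈ S i, p = (s, s ^ 2)})
    (G Fda FdaJ : Set ((Fin n → ℝ) × (Fin n → ℝ) × Matrix (Fin n) (Fin n) ℝ))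
    (hG : G = {t | t.2.2.IsSymm ∧ A.mulVec t.1 = b ∧
      (t.2.2 - Matrix.vecMulVec t.1 t.1).PosSemidef ∧
      (∀ i, t.2.2 i i = t.2.1 i) ∧
      (∀ i, (t.1 i, t.2.1 i) ∈ convexHull ℝ (Cset i))})
    (hFda : Fda = {t ∈ G |
      (∑ i, ∑ j, (Aᵀ * A) i j * t.2.2 i j)
        - 2 * ((Aᵀ.mulVec b) ⬝ᵥ t.1) + b ⬝ᵥ b = 0})
    (hFdaJ : FdaJ = {t ∈ G | ∀ j : ι,
      (∑ i, ∑ k, Cq j i k * t.2.2 i k) + cq j ⬝ᵥ t.1 + γq j = 0})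
    (hne : Fda.Nonempty)
    (hbdd : BddBelow ((fun t : (Fin n → ℝ) × (Fin n → ℝ) × Matrix (Fin n) (Fin n) ℝ =>
      (∑ i, ∑ j, Q i j * t.2.2 i j) + q ⬝ᵥ t.1) '' FdaJ)) :
    sInf ((fun t : (Fin n → ℝ) × (Fin n → ℝ) × Matrix (Fin n) (Fin n) ℝ =>
        (∑ i, ∑ j, Q i j * t.2.2 i j) + q ⬝ᵥ t.1) '' FdaJ)
      ≤ sInf ((fun t : (Fin n → ℝ) × (Fin n → ℝ) × Matrix (Fin n) (Fin n) ℝ =>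
        (∑ i, ∑ j, Q i j * t.2.2 i j) + q ⬝ᵥ t.1) '' Fda) := by
  refine csInf_le_csInf hbdd (hne.image _) (Set.image_mono ?_)
  subst hG hFda hFdaJ
  rintro ⟨x, y, X⟩ ⟨hmem, hagg⟩
  refine ⟨hmem, fun j => ?_⟩
  obtain ⟨hX, hAx, hpsd, -, -⟩ := hmem
  rw [hCdef, hcdef, hγdef]
  exact lifted_vanishing_quadratic_eq_zero hX hAx
    (mul_eq_vecMulVec_of_aggregated hX hAx hpsd hagg) (W j) (β j)
end
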